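/- arXiv:1710.01629 — 3 statements merged into one kernel-verified Lean document; each statement's English description precedes it below -/
import Mathlib

section
/- Let α and β be metric spaces, let φ : ℝ → α → α and ψ : ℝ → β → β be flows (continuous actions of ℝ), and let h : α → β be a homeomorphism conjugating the flows, i.e. h (φ t x) = ψ t (h x) for all t ∈ ℝ and x ∈ α. Let B ⊆ α be a nonempty compact set that is asymptotically stable for φ, i.e. there is an open set N ⊇ B such that for every x ∈ N the infimum distance infDist (φ t x) B tends to 0 as t → ∞. Then the image h '' B is asymptotically stable for ψ: there is an open set N' ⊇ h '' B such that for every y ∈ N', infDist (ψ t y) (h '' B) tends to 0 as t → ∞. -/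
/-- Distance to a nonempty compact set tends to zero iff the map tends to the set itself. -/
theorem IsCompact.tendsto_infDist_zero_iff_nhdsSet {ι γ : Type*} [PseudoMetricSpace γ]
    {K : Set γ} (hK : IsCompact K) (hne : K.Nonempty) {l : Filter ι} {f : ι → γ} :
    Filter.Tendsto (fun i => Metric.infDist (f i) K) l (nhds 0) ↔
      Filter.Tendsto f l (nhdsSet K) := by
  simp [Metric.tendsto_nhdsSet hK hne, Metric.tendsto_nhds, abs_of_nonneg Metric.infDist_nonneg]

/-- abstract Theorem 1 of the paper.
If `h` is a homeomorphism conjugating the flow `φ` on `α` to the flow `ψ` on `β`,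
and the nonempty compact set `B` is asymptotically stable for `φ`, then `h '' B`
is asymptotically stable for `ψ`. -/
theorem conjugate_flow_asymptotic_stability
    {α β : Type*} [MetricSpace α] [MetricSpace β]
    (φ : ℝ → α → α) (ψ : ℝ → β → β)
    (hφc : Continuous fun p : ℝ × α => φ p.1 p.2)
    (hφ0 : ∀ x, φ 0 x = x)
    (hφadd : ∀ s t x, φ (s + t) x = φ s (φ t x))
    (hψc : Continuous fun p : ℝ × β => ψ p.1 p.2)
    (hψ0 : ∀ y, ψ 0 y = y)
    (hψadd : ∀ s t y, ψ (s + t) y = ψ s (ψ t y))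
    (h : α ≃ₜ β)
    (hconj : ∀ (t : ℝ) (x : α), h (φ t x) = ψ t (h x))
    (B : Set α) (hBne : B.Nonempty) (hBcpt : IsCompact B)
    (hstab : ∃ N : Set α, IsOpen N ∧ B ⊆ N ∧
      ∀ x ∈ N, Filter.Tendsto (fun t : ℝ => Metric.infDist (φ t x) B)
        Filter.atTop (nhds 0)) :
    ∃ N' : Set β, IsOpen N' ∧ h '' B ⊆ N' ∧
      ∀ y ∈ N', Filter.Tendsto (fun t : ℝ => Metric.infDist (ψ t y) (h '' B))
        Filter.atTop (nhds 0) := by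
  obtain ⟨N, hNo, hBN, hN⟩ := hstab
  refine ⟨h '' N, h.isOpenMap N hNo, Set.image_mono hBN, ?_⟩
  rintro _ ⟨x, hx, rfl⟩
  rw [(hBcpt.image h.continuous).tendsto_infDist_zero_iff_nhdsSet (hBne.image h)]
  simp only [← hconj]
  exact (h.continuous.tendsto_nhdsSet (Set.mapsTo_image h B)).comp
    ((hBcpt.tendsto_infDist_zero_iff_nhdsSet hBne).1 (hN x hx))
end

section
/- Fix an integer k ≥ 2. Let f : ℝ^{k-1} × ℝ → ℝ^{k-1} be continuously differentiable, let a₁,…,a_{k-1} > 0 and b > 0. Consider, for a parameter ε > 0, the closed-loop slow–fast system in the variables (x, z) ∈ ℝ^{k-1} × ℝ: ẋ₁ = f₁(x,z) − f₁(0,0) + b ε^{−1/(2k−1)} z − a₁ ε^{−k/(2k−1)} x₁; ẋⱼ = fⱼ(x,z) − fⱼ(0,0) − aⱼ ε^{−k/(2k−1)} xⱼ for j = 2,…,k−1; ż = −(z^k + Σ_{i=1}^{k-1} xᵢ z^{i−1}) / ε. Then there exists ε₀ > 0 such that for all ε ∈ (0, ε₀) the origin (x,z) = (0,0) is locally asymptotically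 stable: (i) for every η > 0 there exists δ > 0 such that every solution (x,z) : [0,∞) → ℝ^{k-1} × ℝ of the system with ‖(x(0),z(0))‖ < δ satisfies ‖(x(t),z(t))‖ < η for all t ≥ 0; and (ii) there exists δ₀ > 0 such that every solution with ‖(x(0),z(0))‖ < δ₀ satisfies (x(t),z(t)) → (0,0) as t → ∞. -/
open Filter

/-- If a function `V ∘ sol` decreases at rate at least `lam` as long as `sol` is in a ball, then it
decays exponentially from small enough initial values. -/
theorem le_mul_exp_of_deriv_le_on_ball {E : Type*} [NormedAddCommGroup E] {V : E → ℝ}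
    {sol : ℝ → E} {w : ℝ → ℝ} {r lam κ m : ℝ} (hlam : 0 < lam) (hκ : 0 < κ) (hr : 0 < r)
    (hV : ∀ v, κ * ‖v‖ ^ 2 ≤ V v)
    (hd : ∀ t, 0 ≤ t → HasDerivAt (fun τ => V (sol τ)) (w t) t)
    (hw : ∀ t, 0 ≤ t → ‖sol t‖ < r → w t ≤ -lam * V (sol t))
    (hm : 0 < m) (hmr : m < κ * r ^ 2) (h0 : V (sol 0) ≤ m) {t : ℝ} (ht : 0 ≤ t) :
    V (sol t) ≤ m * Real.exp (-(lam / 2) * t) := by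
  have hB : ∀ x, HasDerivAt (fun τ => m * Real.exp (-(lam / 2) * τ))
      (m * (Real.exp (-(lam / 2) * x) * (-(lam / 2)))) x := fun x => by
    have h1 : HasDerivAt (fun τ : ℝ => -(lam / 2) * τ) (-(lam / 2)) x := by
      simpa using (hasDerivAt_id x).const_mul (-(lam / 2))
    exact h1.exp.const_mul m
  refine image_le_of_deriv_right_lt_deriv_boundary (f := fun τ => V (sol τ)) (a := 0) (b := t)
    (f' := w) (fun x hx => (hd x hx.1).continuousAt.continuousWithinAt)
    (fun x hx => (hd x hx.1).hasDerivWithinAt) (by simpa using h0) hB ?_ ⟨ht, le_rfl⟩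
  intro x hx hxe
  have hpos := Real.exp_pos (-(lam / 2) * x)
  have hle : Real.exp (-(lam / 2) * x) ≤ 1 := by
    rw [Real.exp_le_one_iff]; nlinarith [hx.1]
  have hxr : ‖sol x‖ < r := by
    have h1 := hV (sol x)
    rw [hxe] at h1
    have h2 : κ * ‖sol x‖ ^ 2 < κ * r ^ 2 := by nlinarith
    exact lt_of_pow_lt_pow_left₀ 2 hr.le (lt_of_mul_lt_mul_left h2 hκ.le)
  have h3 := hw x hx.1 hxr
  rw [hxe] at h3
  have : 0 < lam * (m * Real.exp (-(lam / 2) * x)) := by positivity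
  nlinarith

/-- Lyapunov's direct method with a function comparable to the squared norm: such a function that
decays exponentially near the origin along a family of curves forces local asymptotic stability. -/
theorem asymptotically_stable_of_lyapunov {E : Type*} [NormedAddCommGroup E]
    {P : (ℝ → E) → Prop} {V : E → ℝ} {r lam κ C : ℝ} (hlam : 0 < lam) (hκ : 0 < κ) (hr : 0 < r)
    (hC : 0 < C) (hV : ∀ v, κ * ‖v‖ ^ 2 ≤ V v) (hVC : ∀ v, V v ≤ C * ‖v‖ ^ 2)
    (hP : ∀ sol, P sol → ∃ w : ℝ → ℝ,
      (∀ t, 0 ≤ t → HasDerivAt (fun τ => V (sol τ)) (w t) t) ∧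
      ∀ t, 0 ≤ t → ‖sol t‖ < r → w t ≤ -lam * V (sol t)) :
    (∀ η > (0 : ℝ), ∃ δ > (0 : ℝ), ∀ sol, P sol → ‖sol 0‖ < δ → ∀ t : ℝ, 0 ≤ t → ‖sol t‖ < η) ∧
    ∃ δ₀ > (0 : ℝ), ∀ sol, P sol → ‖sol 0‖ < δ₀ → Tendsto sol atTop (nhds 0) := by
  have key : ∀ η > (0 : ℝ), ∃ δ > (0 : ℝ), ∀ sol, P sol → ‖sol 0‖ < δ → ∀ t : ℝ, 0 ≤ t →
      ‖sol t‖ ^ 2 ≤ (η ^ 2 / 2) * Real.exp (-(lam / 2) * t) := by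
    intro η hη
    set ρ := min η r with hρ
    have hρ0 : 0 < ρ := lt_min hη hr
    have hρη : ρ ^ 2 ≤ η ^ 2 := pow_le_pow_left₀ hρ0.le (min_le_left _ _) 2
    have hρr : ρ ^ 2 ≤ r ^ 2 := pow_le_pow_left₀ hρ0.le (min_le_right _ _) 2
    refine ⟨Real.sqrt (κ * ρ ^ 2 / 2 / C), by positivity, fun sol hsol h0 t ht => ?_⟩
    obtain ⟨w, hd, hw⟩ := hP sol hsol
    have h1 : V (sol 0) ≤ κ * ρ ^ 2 / 2 := by
      have h2 : ‖sol 0‖ ^ 2 ≤ κ * ρ ^ 2 / 2 / C := by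
        rw [← Real.sq_sqrt (show 0 ≤ κ * ρ ^ 2 / 2 / C by positivity)]
        exact pow_le_pow_left₀ (norm_nonneg _) h0.le 2
      rw [le_div_iff₀ hC] at h2
      linarith [hVC (sol 0)]
    have hm : 0 < κ * ρ ^ 2 / 2 := by positivity
    have h3 := le_mul_exp_of_deriv_le_on_ball hlam hκ hr hV hd hw hm (by nlinarith) h1 ht
    have h4 : κ * ‖sol t‖ ^ 2 ≤ κ * (ρ ^ 2 / 2 * Real.exp (-(lam / 2) * t)) := by
      linarith [hV (sol t)]
    refine (le_of_mul_le_mul_left h4 hκ).trans ?_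
    gcongr
  constructor
  · intro η hη
    obtain ⟨δ, hδ, h⟩ := key η hη
    refine ⟨δ, hδ, fun sol hsol h0 t ht => ?_⟩
    have h1 := h sol hsol h0 t ht
    have h2 : Real.exp (-(lam / 2) * t) ≤ 1 := by
      rw [Real.exp_le_one_iff]; nlinarith
    refine lt_of_pow_lt_pow_left₀ 2 hη.le ?_
    nlinarith [pow_pos hη 2]
  · obtain ⟨δ, hδ, h⟩ := key 1 one_pos
    refine ⟨δ, hδ, fun sol hsol h0 => ?_⟩
    have h1 : Tendsto (fun t : ℝ => ((1 : ℝ) ^ 2 / 2) * Real.exp (-(lam / 2) * t)) atTop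
        (nhds 0) := by
      have h2 : Tendsto (fun t : ℝ => -(lam / 2) * t) atTop atBot :=
        tendsto_id.const_mul_atTop_of_neg (by linarith)
      simpa only [mul_zero, Function.comp_apply] using
        (Real.tendsto_exp_atBot.comp h2).const_mul ((1 : ℝ) ^ 2 / 2)
    have h3 : Tendsto (fun t => ‖sol t‖ ^ 2) atTop (nhds 0) :=
      tendsto_of_tendsto_of_tendsto_of_le_of_le' tendsto_const_nhds h1
        (Eventually.of_forall fun t => by positivity)
        ((eventually_ge_atTop 0).mono fun t ht => h sol hsol h0 t ht)
    rw [tendsto_zero_iff_norm_tendsto_zero]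
    simpa [Real.sqrt_sq] using h3.sqrt

/-- The quadratic form used as a Lyapunov function, in the coordinates `(S • x, z)`. -/
noncomputable def lyapunovForm {ι : Type*} [Fintype ι] (i₀ : ι) (S b c : ℝ) (v : (ι → ℝ) × ℝ) : ℝ :=
  ∑ i, (S * v.1 i) ^ 2 + b * v.2 ^ 2 - c * (S * v.1 i₀ * v.2)

section LyapunovForm

variable {ι : Type*} [Fintype ι] {i₀ : ι} {S b c : ℝ}

theorem hasDerivAt_lyapunovForm {sol : ℝ → (ι → ℝ) × ℝ} {dx : ι → ℝ} {dz t : ℝ}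
    (h : HasDerivAt sol (dx, dz) t) :
    HasDerivAt (fun τ => lyapunovForm i₀ S b c (sol τ))
      (2 * ∑ i, S * (sol t).1 i * (S * dx i) + 2 * b * (sol t).2 * dz
        - c * (S * dx i₀ * (sol t).2 + S * (sol t).1 i₀ * dz)) t := by
  have hz : HasDerivAt (fun τ => (sol τ).2) dz t := h.snd
  have hx : ∀ i, HasDerivAt (fun τ => (sol τ).1 i) (dx i) t := hasDerivAt_pi.1 h.fst
  have h1 : HasDerivAt (fun τ => ∑ i, (S * (sol τ).1 i) ^ 2)
      (∑ i, 2 * (S * (sol t).1 i * (S * dx i))) t := by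
    refine HasDerivAt.fun_sum fun i _ => ?_
    refine (((hx i).const_mul S).fun_pow 2).congr_deriv ?_
    push_cast
    ring
  have h2 := (h1.add ((hz.pow 2).const_mul b)).sub
    ((((hx i₀).const_mul S).mul hz).const_mul c)
  refine h2.congr_deriv ?_
  rw [Finset.mul_sum]
  push_cast
  ring

theorem sq_le_sum_sq (x : ι → ℝ) (i : ι) : x i ^ 2 ≤ ∑ j, x j ^ 2 :=
  Finset.single_le_sum (f := fun j => x j ^ 2) (fun _ _ => sq_nonneg _) (Finset.mem_univ i)

theorem norm_sq_le_sum_sq (hS : 1 ≤ S) (v : (ι → ℝ) × ℝ) :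
    ‖v‖ ^ 2 ≤ ∑ i, (S * v.1 i) ^ 2 + v.2 ^ 2 := by
  set N := ∑ i, (S * v.1 i) ^ 2 + v.2 ^ 2 with hN
  have hsum : 0 ≤ ∑ i, (S * v.1 i) ^ 2 := Finset.sum_nonneg fun i _ => sq_nonneg _
  have hN0 : 0 ≤ N := by positivity
  suffices h : ‖v‖ ≤ Real.sqrt N by
    calc ‖v‖ ^ 2 ≤ Real.sqrt N ^ 2 := pow_le_pow_left₀ (norm_nonneg _) h 2
      _ = N := Real.sq_sqrt hN0
  rw [Prod.norm_def]
  refine max_le ((pi_norm_le_iff_of_nonneg (Real.sqrt_nonneg _)).2 fun i => ?_) ?_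
  · refine Real.abs_le_sqrt ?_
    have h1 := sq_le_sum_sq (fun i => S * v.1 i) i
    have h2 : v.1 i ^ 2 ≤ (S * v.1 i) ^ 2 := by
      rw [mul_pow]
      exact le_mul_of_one_le_left (sq_nonneg _) (one_le_pow₀ hS)
    linarith [sq_nonneg v.2]
  · exact Real.abs_le_sqrt (by linarith)

theorem sum_sq_le_norm_sq (v : (ι → ℝ) × ℝ) :
    ∑ i, (S * v.1 i) ^ 2 + v.2 ^ 2 ≤ (Fintype.card ι * S ^ 2 + 1) * ‖v‖ ^ 2 := by
  have h1 : ∑ i, (S * v.1 i) ^ 2 ≤ ∑ _i : ι, S ^ 2 * ‖v‖ ^ 2 := by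
    refine Finset.sum_le_sum fun i _ => ?_
    rw [mul_pow]
    refine mul_le_mul_of_nonneg_left ?_ (sq_nonneg S)
    exact sq_le_sq.2 (by simpa using (norm_le_pi_norm v.1 i).trans (norm_fst_le v))
  have h2 : v.2 ^ 2 ≤ ‖v‖ ^ 2 := sq_le_sq.2 (by simpa using norm_snd_le v)
  simp only [Finset.sum_const, Finset.card_univ, nsmul_eq_mul] at h1
  linarith

theorem lyapunovForm_ge (hcb : c ^ 2 ≤ b) (v : (ι → ℝ) × ℝ) :
    min 1 b / 2 * (∑ i, (S * v.1 i) ^ 2 + v.2 ^ 2) ≤ lyapunovForm i₀ S b c v := by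
  unfold lyapunovForm
  have h1 := sq_le_sum_sq (fun i => S * v.1 i) i₀
  have h2 := mul_le_mul_of_nonneg_right hcb (sq_nonneg v.2)
  have h3 := mul_le_mul_of_nonneg_right (min_le_right 1 b) (sq_nonneg v.2)
  have h4 := mul_le_mul_of_nonneg_right (min_le_left 1 b) ((sq_nonneg _).trans h1)
  nlinarith [sq_nonneg (S * v.1 i₀ - c * v.2)]

theorem lyapunovForm_le (hb : 0 < b) (hcb : c ^ 2 ≤ b) (v : (ι → ℝ) × ℝ) :
    lyapunovForm i₀ S b c v ≤ 2 * (1 + b) * (∑ i, (S * v.1 i) ^ 2 + v.2 ^ 2) := by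
  unfold lyapunovForm
  have h1 := sq_le_sum_sq (fun i => S * v.1 i) i₀
  have h2 := mul_le_mul_of_nonneg_right hcb (sq_nonneg v.2)
  have h3 := mul_nonneg hb.le (sq_nonneg v.2)
  have h4 := mul_nonneg hb.le ((sq_nonneg _).trans h1)
  nlinarith [sq_nonneg (S * v.1 i₀ + c * v.2), sq_nonneg v.2]

/-- The derivative of the Lyapunov form along a small perturbation of the rescaled linear system. -/
theorem lyapunovForm_deriv_le [DecidableEq ι] {a X p : ι → ℝ} {z q K α θ R : ℝ} (hb : 0 < b)
    (hc : 0 < c) (hK : 0 ≤ K) (hα : ∀ i, α ≤ a i) (hcα : c * (1 + a i₀ ^ 2 / (2 * b)) ≤ α)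
    (hR : 0 ≤ R) (hRN : R ^ 2 = ∑ i, X i ^ 2 + z ^ 2)
    (hp : ∀ i, |p i| ≤ θ * R) (hq : |q| ≤ θ * R) :
    2 * ∑ i, X i * (p i + (if i = i₀ then K * b * z else 0) - K * a i * X i)
        + 2 * b * z * (q - K * X i₀)
        - c * ((p i₀ + K * b * z - K * a i₀ * X i₀) * z + X i₀ * (q - K * X i₀))
      ≤ -(K * min α (c * b / 2)) * R ^ 2
        + θ * (2 * Fintype.card ι + 2 * b + 2 * c) * R ^ 2 := by
  have hsplit : ∑ i, X i * (p i + (if i = i₀ then K * b * z else 0) - K * a i * X i)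
      = ∑ i, X i * p i + X i₀ * (K * b * z) - K * ∑ i, a i * X i ^ 2 := by
    have hite : X i₀ * (K * b * z) = ∑ i, if i = i₀ then X i * (K * b * z) else 0 := by simp
    rw [Finset.mul_sum, hite, ← Finset.sum_add_distrib, ← Finset.sum_sub_distrib]
    refine Finset.sum_congr rfl fun i _ => ?_
    split_ifs <;> ring
  have hXR : ∀ i, |X i| ≤ R := fun i => abs_le_of_sq_le_sq (by
    nlinarith [sq_le_sum_sq X i, sq_nonneg z]) hR
  have hzR : |z| ≤ R := abs_le_of_sq_le_sq (by
    nlinarith [Finset.sum_nonneg fun i (_ : i ∈ Finset.univ) => sq_nonneg (X i)]) hR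
  have hprod : ∀ {u y : ℝ}, |u| ≤ R → |y| ≤ θ * R → |u * y| ≤ θ * R ^ 2 := fun hu hy => by
    rw [abs_mul]
    calc _ ≤ R * (θ * R) := mul_le_mul hu hy (abs_nonneg _) hR
      _ = θ * R ^ 2 := by ring
  have hXp : ∑ i, X i * p i ≤ Fintype.card ι * (θ * R ^ 2) := by
    have := Finset.sum_le_sum fun i (_ : i ∈ Finset.univ) =>
      (le_abs_self _).trans (hprod (hXR i) (hp i))
    simpa using this
  have hzq := mul_le_mul_of_nonneg_left ((le_abs_self _).trans (hprod hzR hq)) hb.le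
  have hzp := mul_le_mul_of_nonneg_left ((neg_le_abs _).trans (hprod hzR (hp i₀))) hc.le
  have hXq := mul_le_mul_of_nonneg_left ((neg_le_abs _).trans (hprod (hXR i₀) hq)) hc.le
  have haX : α * ∑ i, X i ^ 2 ≤ ∑ i, a i * X i ^ 2 := by
    rw [Finset.mul_sum]
    exact Finset.sum_le_sum fun i _ => mul_le_mul_of_nonneg_right (hα i) (sq_nonneg _)
  have hX0 := sq_le_sum_sq X i₀
  have hs0 : 0 ≤ ∑ i, X i ^ 2 := (sq_nonneg _).trans hX0
  have hα0 : 0 ≤ α := le_trans (by positivity) hcα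
  have hyoung : c * a i₀ * X i₀ * z ≤ c * b / 2 * z ^ 2 + c * (a i₀ ^ 2 / (2 * b)) * X i₀ ^ 2 := by
    have : c * b / 2 * z ^ 2 + c * (a i₀ ^ 2 / (2 * b)) * X i₀ ^ 2 - c * a i₀ * X i₀ * z
        = c / (2 * b) * (b * z - a i₀ * X i₀) ^ 2 := by field_simp; ring
    have : 0 ≤ c / (2 * b) * (b * z - a i₀ * X i₀) ^ 2 := by positivity
    linarith
  have hαX : c * (1 + a i₀ ^ 2 / (2 * b)) * X i₀ ^ 2 ≤ α * ∑ i, X i ^ 2 :=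
    mul_le_mul hcα hX0 (sq_nonneg _) hα0
  have hmin : min α (c * b / 2) * R ^ 2 ≤ α * ∑ i, X i ^ 2 + c * b / 2 * z ^ 2 := by
    rw [hRN, mul_add]
    exact add_le_add (mul_le_mul_of_nonneg_right (min_le_left _ _) hs0)
      (mul_le_mul_of_nonneg_right (min_le_right _ _) (sq_nonneg _))
  have hmain : min α (c * b / 2) * R ^ 2 ≤
      2 * ∑ i, a i * X i ^ 2 + c * b * z ^ 2 - c * a i₀ * X i₀ * z - c * X i₀ ^ 2 := by
    linarith
  have hmainK := mul_le_mul_of_nonneg_left hmain hK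
  rw [hsplit]
  linarith

end LyapunovForm

/-- Near the origin `z ^ k + ∑ xᵢ zⁱ` is a small perturbation of `x₀`. -/
theorem abs_critical_sub_le {k : ℕ} (hk : 2 ≤ k) {i₀ : Fin (k - 1)} (hi₀ : (i₀ : ℕ) = 0) {ρ : ℝ}
    (hρ1 : ρ ≤ 1) (v : (Fin (k - 1) → ℝ) × ℝ) (hv : ‖v‖ ≤ ρ) :
    |v.2 ^ k + ∑ i : Fin (k - 1), v.1 i * v.2 ^ (i : ℕ) - v.1 i₀|
      ≤ k * (ρ * ‖v‖) := by
  have hρ0 : 0 ≤ ρ := (norm_nonneg _).trans hv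
  have hz : |v.2| ≤ ‖v‖ := norm_snd_le v
  have hx : ∀ i, |v.1 i| ≤ ‖v‖ := fun i => (norm_le_pi_norm v.1 i).trans (norm_fst_le v)
  have hpow : ∀ n : ℕ, n ≠ 0 → |v.2 ^ n| ≤ |v.2| := fun n hn => by
    rw [abs_pow]
    exact pow_le_of_le_one (abs_nonneg _) (hz.trans (hv.trans hρ1)) hn
  have h1 : |v.2 ^ k| ≤ ρ * ‖v‖ := by
    obtain ⟨m, rfl⟩ := Nat.exists_eq_add_of_le' (show 1 ≤ k by omega)
    rw [pow_succ, abs_mul]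
    exact mul_le_mul ((hpow m (by omega)).trans (hz.trans hv)) hz (abs_nonneg _) hρ0
  have h2 : ∑ i : Fin (k - 1), v.1 i * v.2 ^ (i : ℕ) - v.1 i₀
      = ∑ i : Fin (k - 1), if i = i₀ then 0 else v.1 i * v.2 ^ (i : ℕ) := by
    have hite : v.1 i₀ = ∑ i : Fin (k - 1), if i = i₀ then v.1 i else 0 := by simp
    rw [sub_eq_iff_eq_add, hite, ← Finset.sum_add_distrib]
    refine Finset.sum_congr rfl fun i _ => ?_
    split_ifs with h
    · subst h; simp [hi₀]
    · simp
  have h3 : |∑ i : Fin (k - 1), if i = i₀ then 0 else v.1 i * v.2 ^ (i : ℕ)|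
      ≤ ((k : ℝ) - 1) * (ρ * ‖v‖) := by
    refine (Finset.abs_sum_le_sum_abs _ _).trans ?_
    have : ∑ i : Fin (k - 1), |if i = i₀ then 0 else v.1 i * v.2 ^ (i : ℕ)|
        ≤ ∑ _i : Fin (k - 1), ρ * ‖v‖ := by
      refine Finset.sum_le_sum fun i _ => ?_
      split_ifs with h
      · rw [abs_zero]; positivity
      · rw [abs_mul, mul_comm]
        refine mul_le_mul ((hpow _ fun h' => h (Fin.ext (h'.trans hi₀.symm))).trans (hz.trans hv))
          (hx i) (abs_nonneg _) hρ0
    simpa [Nat.cast_sub (show 1 ≤ k by omega)] using this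
  rw [add_sub_assoc, h2]
  refine (abs_add_le _ _).trans ?_
  linarith

/-- A `C¹` map into a finite product is coordinatewise Lipschitz near the origin. -/
theorem exists_forall_abs_sub_le {E ι : Type*} [NormedAddCommGroup E] [NormedSpace ℝ E] [Fintype ι]
    {f : E → ι → ℝ} (hf : ContDiff ℝ 1 f) :
    ∃ L > (0 : ℝ), ∃ r > (0 : ℝ), ∀ v, ‖v‖ < r → ∀ i, |f v i - f 0 i| ≤ L * ‖v‖ := by
  obtain ⟨L, U, hU, hL⟩ := (hf.contDiffAt (x := 0)).exists_lipschitzOnWith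
  obtain ⟨r, hr, hrU⟩ := Metric.mem_nhds_iff.1 hU
  refine ⟨L + 1, by positivity, r, hr, fun v hv i => ?_⟩
  have h1 := hL.norm_sub_le (hrU (by simpa using hv)) (mem_of_mem_nhds hU)
  have h2 : |f v i - f 0 i| ≤ ‖f v - f 0‖ := norm_le_pi_norm (f v - f 0) i
  rw [sub_zero] at h1
  nlinarith [norm_nonneg v]

/-- Theorem 2 of the paper.
For the slow–fast control system `ẋ = f(x,z) + u`, `ε ż = −(z^k + Σᵢ xᵢ z^{i−1})`
with the controller `u = −C + b ε^{−1/(2k−1)} z ê₁ − ε^{−k/(2k−1)} A x`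
(`C = (fᵢ(0,0))ᵢ`, `A = diag{aᵢ}`, `aᵢ > 0`, `b > 0`), the origin of the closed-loop
system is locally asymptotically stable for all sufficiently small `ε > 0`.
Here `x : Fin (k-1) → ℝ` is 0-indexed, so the paper's `xᵢ` is `x ⟨i-1,_⟩` and
`z^{i-1}` is `z ^ (i : ℕ)` for `i : Fin (k-1)`. -/
theorem slow_fast_controller_local_asymptotic_stability
    (k : ℕ) (hk : 2 ≤ k)
    (f : (Fin (k - 1) → ℝ) × ℝ → Fin (k - 1) → ℝ)
    (hf : ContDiff ℝ 1 f)
    (a : Fin (k - 1) → ℝ) (ha : ∀ i, 0 < a i)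
    (b : ℝ) (hb : 0 < b) :
    ∃ ε₀ > (0 : ℝ), ∀ ε : ℝ, 0 < ε → ε < ε₀ →
      -- (i) Lyapunov stability of the origin
      ((∀ η > (0 : ℝ), ∃ δ > (0 : ℝ),
        ∀ sol : ℝ → (Fin (k - 1) → ℝ) × ℝ,
          (∀ t : ℝ, 0 ≤ t → HasDerivAt sol
            ((fun i => f (sol t) i - f (0, 0) i
                + (if i = (⟨0, by omega⟩ : Fin (k - 1)) then
                    b * ε ^ (-(1 : ℝ) / (2 * (k : ℝ) - 1)) * (sol t).2 else 0)
                - a i * ε ^ (-(k : ℝ) / (2 * (k : ℝ) - 1)) * (sol t).1 i,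
              -(((sol t).2) ^ k
                  + ∑ i : Fin (k - 1), (sol t).1 i * ((sol t).2) ^ (i : ℕ)) / ε)) t) →
          ‖sol 0‖ < δ → ∀ t : ℝ, 0 ≤ t → ‖sol t‖ < η) ∧
      -- (ii) local attractivity of the origin
      (∃ δ₀ > (0 : ℝ),
        ∀ sol : ℝ → (Fin (k - 1) → ℝ) × ℝ,
          (∀ t : ℝ, 0 ≤ t → HasDerivAt sol
            ((fun i => f (sol t) i - f (0, 0) i
                + (if i = (⟨0, by omega⟩ : Fin (k - 1)) then
                    b * ε ^ (-(1 : ℝ) / (2 * (k : ℝ) - 1)) * (sol t).2 else 0)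
                - a i * ε ^ (-(k : ℝ) / (2 * (k : ℝ) - 1)) * (sol t).1 i,
              -(((sol t).2) ^ k
                  + ∑ i : Fin (k - 1), (sol t).1 i * ((sol t).2) ^ (i : ℕ)) / ε)) t) →
          ‖sol 0‖ < δ₀ → Tendsto sol atTop (nhds 0))) := by
  obtain ⟨L, hL, r₀, hr₀, hfL⟩ := exists_forall_abs_sub_le hf
  set i₀ : Fin (k - 1) := ⟨0, by omega⟩ with hi₀
  obtain ⟨α, hα, hαa⟩ : ∃ α > 0, ∀ i, α ≤ a i := by
    have : Nonempty (Fin (k - 1)) := ⟨i₀⟩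
    obtain ⟨j, hj⟩ := Finite.exists_min a
    exact ⟨a j, ha j, hj⟩
  set c : ℝ := min (α / (1 + a i₀ ^ 2 / (2 * b))) (Real.sqrt b) with hc_def
  have hD : 0 < 1 + a i₀ ^ 2 / (2 * b) := by positivity
  have hc : 0 < c := lt_min (by positivity) (by positivity)
  have hcα : c * (1 + a i₀ ^ 2 / (2 * b)) ≤ α := (le_div_iff₀ hD).1 (min_le_left _ _)
  have hcb : c ^ 2 ≤ b := by
    calc c ^ 2 ≤ Real.sqrt b ^ 2 := pow_le_pow_left₀ hc.le (min_le_right _ _) 2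
      _ = b := Real.sq_sqrt hb.le
  set μ : ℝ := min α (c * b / 2) with hμ_def
  have hμ : 0 < μ := lt_min hα (by positivity)
  set M : ℝ := 2 * Fintype.card (Fin (k - 1)) + 2 * b + 2 * c with hM_def
  have hM : 0 < M := by positivity
  have hk' : (2 : ℝ) ≤ k := by exact_mod_cast hk
  have hk1 : 0 < 2 * (k : ℝ) - 1 := by linarith
  have hev : ∀ᶠ ε : ℝ in nhdsWithin 0 (Set.Ioi 0),
      max 1 (2 * L * M / μ) ≤ ε ^ (-(1 : ℝ) / (2 * (k : ℝ) - 1)) :=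
    (tendsto_rpow_neg_nhdsGT_zero (div_neg_of_neg_of_pos (by norm_num) hk1)).eventually_ge_atTop _
  obtain ⟨ε₀, hε₀, hε₀s⟩ := mem_nhdsGT_iff_exists_Ioo_subset.1 hev
  refine ⟨ε₀, hε₀, fun ε hε hεε => ?_⟩
  have hs : max 1 (2 * L * M / μ) ≤ ε ^ (-(1 : ℝ) / (2 * (k : ℝ) - 1)) := hε₀s ⟨hε, hεε⟩
  have hK : ε ^ (-(k : ℝ) / (2 * (k : ℝ) - 1))
      = (ε ^ (-(1 : ℝ) / (2 * (k : ℝ) - 1))) ^ k := by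
    rw [← Real.rpow_mul_natCast hε.le]
    congr 1
    ring
  have hinv : 1 / ε = (ε ^ (-(1 : ℝ) / (2 * (k : ℝ) - 1))) ^ (2 * k - 1) := by
    rw [← Real.rpow_mul_natCast hε.le, Nat.cast_sub (by omega)]
    push_cast
    rw [div_mul_cancel₀ _ hk1.ne', Real.rpow_neg_one, one_div]
  rw [hK]
  generalize ε ^ (-(1 : ℝ) / (2 * (k : ℝ) - 1)) = s at hs hinv
  have hs1 : 1 ≤ s := (le_max_left _ _).trans hs
  have hs0 : 0 < s := by linarith
  have hsM : L * M ≤ s * μ / 2 := by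
    have := (div_le_iff₀ hμ).1 ((le_max_right _ _).trans hs)
    linarith
  set S : ℝ := s ^ (k - 1) with hS_def
  have hS1 : 1 ≤ S := one_le_pow₀ hs1
  have hS0 : 0 < S := by linarith
  have hsk : s ^ k = S * s := by rw [hS_def, ← pow_succ]; congr 1; omega
  have hsinv : 1 / ε = s ^ k * S := by rw [hinv, hS_def, ← pow_add]; congr 1; omega
  rw [hsk] at *
  set K : ℝ := S * s with hK_def
  have hK0 : 0 < K := by positivity
  set ρ : ℝ := min 1 (S * L * ε / k) with hρ_def
  have hk0 : (0 : ℝ) < k := by linarith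
  have hρ0 : 0 < ρ := lt_min one_pos (by positivity)
  have hρk : k * ρ / ε ≤ S * L := by
    have : ρ ≤ S * L * ε / k := min_le_right _ _
    rw [le_div_iff₀ hk0] at this
    rw [div_le_iff₀ hε]
    linarith
  have hmb : 0 < min 1 b := lt_min one_pos hb
  refine asymptotically_stable_of_lyapunov (V := lyapunovForm i₀ S b c) (r := min r₀ ρ)
    (lam := K * μ / 2 / (2 * (1 + b))) (κ := min 1 b / 2)
    (C := 2 * (1 + b) * (Fintype.card (Fin (k - 1)) * S ^ 2 + 1))
    (by positivity) (by positivity) (lt_min hr₀ hρ0) (by positivity)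
    (fun v => (mul_le_mul_of_nonneg_left (norm_sq_le_sum_sq hS1 v) (by positivity)).trans
      (lyapunovForm_ge hcb v))
    (fun v => (lyapunovForm_le hb hcb v).trans (by
      rw [mul_assoc _ _ (‖v‖ ^ 2)]
      exact mul_le_mul_of_nonneg_left (sum_sq_le_norm_sq v) (by positivity)))
    (fun sol hsol => ⟨_, fun t ht => hasDerivAt_lyapunovForm (hsol t ht), fun t ht htr => ?_⟩)
  generalize sol t = v at htr
  set N : ℝ := ∑ i, (S * v.1 i) ^ 2 + v.2 ^ 2 with hN_def
  have hvN : ‖v‖ ^ 2 ≤ N := norm_sq_le_sum_sq hS1 v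
  have hN0 : 0 ≤ N := (sq_nonneg _).trans hvN
  have hvR : ‖v‖ ≤ Real.sqrt N := Real.le_sqrt_of_sq_le hvN
  have hp : ∀ i, |S * (f v i - f (0, 0) i)| ≤ S * L * Real.sqrt N := fun i => by
    rw [abs_mul, abs_of_pos hS0, mul_assoc]
    refine mul_le_mul_of_nonneg_left ?_ hS0.le
    exact (hfL v (htr.trans_le (min_le_left _ _)) i).trans (mul_le_mul_of_nonneg_left hvR hL.le)
  set g : ℝ := v.2 ^ k + ∑ i : Fin (k - 1), v.1 i * v.2 ^ (i : ℕ) with hg_def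
  have hq : |-(g - v.1 i₀) / ε| ≤ S * L * Real.sqrt N := by
    have h1 : |g - v.1 i₀| ≤ k * (ρ * ‖v‖) :=
      abs_critical_sub_le hk rfl (min_le_left _ _) v (htr.le.trans (min_le_right _ _))
    rw [abs_div, abs_neg, abs_of_pos hε]
    calc |g - v.1 i₀| / ε ≤ k * (ρ * ‖v‖) / ε := by gcongr
      _ = k * ρ / ε * ‖v‖ := by ring
      _ ≤ S * L * Real.sqrt N := mul_le_mul hρk hvR (norm_nonneg _) (by positivity)
  have hmain := lyapunovForm_deriv_le (i₀ := i₀) (X := fun i => S * v.1 i) (a := a) (z := v.2)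
    hb hc hK0.le hαa hcα (Real.sqrt_nonneg N) (Real.sq_sqrt hN0) hp hq
  rw [Real.sq_sqrt hN0, ← hμ_def, ← hM_def] at hmain
  have hdx : ∀ i, S * (f v i - f (0, 0) i + (if i = i₀ then b * s * v.2 else 0)
        - a i * K * v.1 i)
      = S * (f v i - f (0, 0) i) + (if i = i₀ then K * b * v.2 else 0)
        - K * a i * (S * v.1 i) := fun i => by
    split_ifs
    · rw [hK_def]; ring
    · ring
  have hdz : -g / ε = -(g - v.1 i₀) / ε - K * (S * v.1 i₀) := by
    rw [← mul_assoc, ← hsinv]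
    ring
  have hV := lyapunovForm_le (i₀ := i₀) (S := S) hb hcb v
  rw [← hN_def] at hV
  simp only [hdx, hdz, if_true]
  have h2 : K * μ / 2 / (2 * (1 + b)) * lyapunovForm i₀ S b c v ≤ K * μ / 2 * N := by
    rw [div_mul_eq_mul_div, div_le_iff₀ (by positivity)]
    calc _ ≤ K * μ / 2 * (2 * (1 + b) * N) := mul_le_mul_of_nonneg_left hV (by positivity)
      _ = _ := by ring
  have h3 : S * L * M * N ≤ K * μ / 2 * N := by
    refine mul_le_mul_of_nonneg_right ?_ hN0
    calc S * L * M = S * (L * M) := mul_assoc _ _ _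
      _ ≤ S * (s * μ / 2) := mul_le_mul_of_nonneg_left hsM hS0.le
      _ = K * μ / 2 := by rw [hK_def]; ring
  linarith
end

section
/- Fix an integer k ≥ 2. Let f : ℝ^{k-1} × ℝ → ℝ^{k-1} be continuously differentiable, a₁,…,a_{k-1} > 0, b > 0, K₁,…,K_{k-1} ≥ 0 and χ₁*,…,χ_{k-1}* ∈ ℝ. Consider, for a parameter ε > 0, the closed-loop system in (x, z) ∈ ℝ^{k-1} × ℝ: ẋ₁ = f₁(x,z) − f₁(0,0) + b ε^{−1/(2k−1)} z − a₁ ε^{−k/(2k−1)} x₁ + K₁ ( x₁ z + (−z)^{k+1} χ₁* ); ẋⱼ = fⱼ(x,z) − fⱼ(0,0) − aⱼ ε^{−k/(2k−1)} xⱼ + Kⱼ ( xⱼ z + (−z)^{k−j+2} χⱼ* ) for j = 2,…,k−1; ż = −( z^k + Σ_{i=1}^{k-1} xᵢ z^{i−1} ) / ε. Then there exists ε₀ > 0 such that for all ε ∈ (0, ε₀) the origin is locally asymptotically stable: for every η > 0 there exists δ > 0 such that every solution on [0,∞) with initial norm less than δ stays within norm η, and there exists δ₀ > 0 such that every solution with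 initial norm less than δ₀ converges to the origin as t → ∞. -/
open Filter

open Asymptotics Topology

/-- A differentiable function that decays exponentially as long as it stays below the level `R`
decays exponentially if it starts below `R' < R`. -/
lemma le_mul_exp_of_hasDerivAt_le_neg_mul {v v' : ℝ → ℝ} {c R R' : ℝ} (hc : 0 < c) (hR' : 0 < R')
    (hRR : R' < R) (hv : ∀ t, 0 ≤ t → HasDerivAt v (v' t) t)
    (hdecay : ∀ t, 0 ≤ t → v t < R → v' t ≤ -c * v t) (h0 : v 0 ≤ R') {t : ℝ} (ht : 0 ≤ t) :
    v t ≤ R' * Real.exp (-(c / 2) * t) := by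
  have hB : ∀ x, HasDerivAt (fun x => R' * Real.exp (-(c / 2) * x))
      (R' * (Real.exp (-(c / 2) * x) * (-(c / 2) * 1))) x := fun x =>
    (((hasDerivAt_id x).const_mul (-(c / 2))).exp).const_mul R'
  refine image_le_of_deriv_right_lt_deriv_boundary (a := 0) (b := t) (f := v) (f' := v')
    (fun x hx => (hv x hx.1).continuousAt.continuousWithinAt)
    (fun x hx => (hv x hx.1).hasDerivWithinAt) (by simpa using h0) hB ?_ ⟨ht, le_rfl⟩
  intro x hx hxB
  have hpos : 0 < R' * Real.exp (-(c / 2) * x) := by positivity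
  have hle : R' * Real.exp (-(c / 2) * x) ≤ R' := by
    refine mul_le_of_le_one_right hR'.le (Real.exp_le_one_iff.2 ?_)
    have := mul_nonneg hc.le hx.1
    linarith
  have := hdecay x hx.1 (by linarith)
  rw [hxB] at this
  nlinarith

/-- A coercive function that decays exponentially along `F` near the origin yields Lyapunov
stability and local attractivity of the origin for the differential equation `ẏ = F y`. -/
lemma stable_and_attractive_of_lyapunov {E : Type*} [NormedAddCommGroup E] [NormedSpace ℝ E]
    (F : E → E) (V : E → ℝ) (V' : E → E → ℝ) {m c ρ : ℝ} (hm : 0 < m) (hc : 0 < c) (hρ : 0 < ρ)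
    (hV : ∀ (y : ℝ → E) (w : E) (t : ℝ), HasDerivAt y w t →
      HasDerivAt (fun t => V (y t)) (V' (y t) w) t)
    (hVm : ∀ p, m * ‖p‖ ^ 2 ≤ V p) (hVc : Tendsto V (𝓝 0) (𝓝 0))
    (hdecay : ∀ p, ‖p‖ < ρ → V' p (F p) ≤ -c * V p) :
    (∀ η > (0 : ℝ), ∃ δ > (0 : ℝ), ∀ y : ℝ → E,
      (∀ t : ℝ, 0 ≤ t → HasDerivAt y (F (y t)) t) → ‖y 0‖ < δ → ∀ t : ℝ, 0 ≤ t → ‖y t‖ < η) ∧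
    (∃ δ₀ > (0 : ℝ), ∀ y : ℝ → E,
      (∀ t : ℝ, 0 ≤ t → HasDerivAt y (F (y t)) t) → ‖y 0‖ < δ₀ → Tendsto y atTop (𝓝 0)) := by
  have key : ∀ η > (0 : ℝ), η ≤ ρ → ∃ δ > (0 : ℝ), ∀ y : ℝ → E,
      (∀ t : ℝ, 0 ≤ t → HasDerivAt y (F (y t)) t) → ‖y 0‖ < δ →
      ∀ t : ℝ, 0 ≤ t → m * ‖y t‖ ^ 2 ≤ m * η ^ 2 / 2 * Real.exp (-(c / 2) * t) := by
    intro η hη hηρ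
    have hR : 0 < m * η ^ 2 := by positivity
    obtain ⟨δ, hδ, hball⟩ := Metric.eventually_nhds_iff.1
      (hVc.eventually (gt_mem_nhds (half_pos hR)))
    refine ⟨δ, hδ, fun y hy h0 t ht => (hVm _).trans ?_⟩
    refine le_mul_exp_of_hasDerivAt_le_neg_mul (v := fun t => V (y t)) hc (half_pos hR)
      (half_lt_self hR) (fun t ht => hV y _ t (hy t ht)) ?_ (hball (by simpa using h0)).le ht
    intro t _ hlt
    refine hdecay _ (lt_of_lt_of_le ?_ hηρ)
    exact lt_of_pow_lt_pow_left₀ 2 hη.le (lt_of_mul_lt_mul_left ((hVm _).trans_lt hlt) hm.le)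
  refine ⟨fun η hη => ?_, ?_⟩
  · have hη' : 0 < min η ρ := lt_min hη hρ
    obtain ⟨δ, hδ, h⟩ := key (min η ρ) hη' (min_le_right _ _)
    refine ⟨δ, hδ, fun y hy h0 t ht => lt_of_lt_of_le ?_ (min_le_left η ρ)⟩
    have h1 := h y hy h0 t ht
    have h2 : Real.exp (-(c / 2) * t) ≤ 1 := by
      refine Real.exp_le_one_iff.2 ?_
      have := mul_nonneg hc.le ht
      linarith
    have h3 : 0 < m * min η ρ ^ 2 := by positivity
    refine lt_of_pow_lt_pow_left₀ 2 hη'.le (lt_of_mul_lt_mul_left ?_ hm.le)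
    nlinarith
  · obtain ⟨δ, hδ, h⟩ := key ρ hρ le_rfl
    refine ⟨δ, hδ, fun y hy h0 => ?_⟩
    have hexp : Tendsto (fun t : ℝ => ρ ^ 2 / 2 * Real.exp (-(c / 2) * t)) atTop (𝓝 0) := by
      have : Tendsto (fun t : ℝ => -(c / 2) * t) atTop atBot :=
        tendsto_id.const_mul_atTop_of_neg (by linarith)
      simpa using (Real.tendsto_exp_atBot.comp this).const_mul (ρ ^ 2 / 2)
    have hsq : Tendsto (fun t => ‖y t‖ ^ 2) atTop (𝓝 0) := by
      refine squeeze_zero' (Eventually.of_forall fun t => by positivity) ?_ hexp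
      filter_upwards [eventually_ge_atTop 0] with t ht
      refine le_of_mul_le_mul_left ?_ hm
      linarith [h y hy h0 t ht]
    rw [tendsto_zero_iff_norm_tendsto_zero]
    simpa using hsq.sqrt

/-- Dissipation of `∑ Xᵢ² + b Z² - 2 γ X_{i₀} Z` along the perturbed system
`Ẋ = b Z ê_{i₀} - A X + e`, `Ż = -X_{i₀} + e₀`. -/
lemma lyapunov_dissipation {n : ℕ} (i₀ : Fin n) (a X e : Fin n → ℝ) {b γ μ θ Z e₀ q : ℝ}
    (hb : 0 < b) (hγ : 0 < γ) (hγa : γ * (2 + a i₀ ^ 2 / b) ≤ a i₀)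
    (hμa : ∀ i, μ ≤ a i) (hapos : ∀ i, 0 < a i) (hμb : μ ≤ γ * b)
    (hq : 0 ≤ q) (hqQ : q ^ 2 = ∑ i, X i ^ 2 + Z ^ 2)
    (hθ : θ * (2 * n + 2 * b + 4 * γ) ≤ μ / 2)
    (he : ∀ i, |e i| ≤ θ * q) (he₀ : |e₀| ≤ θ * q) :
    ∑ i, 2 * X i * ((if i = i₀ then b * Z else 0) - a i * X i + e i) + 2 * b * Z * (-X i₀ + e₀)
      - 2 * γ * ((b * Z - a i₀ * X i₀ + e i₀) * Z + X i₀ * (-X i₀ + e₀)) ≤ -(μ / 2) * q ^ 2 := by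
  have hXq : ∀ i, |X i| ≤ q := fun i => by
    refine abs_le_of_sq_le_sq (?_ : X i ^ 2 ≤ q ^ 2) hq
    have := Finset.single_le_sum (f := fun i => X i ^ 2) (fun i _ => sq_nonneg _)
      (Finset.mem_univ i)
    nlinarith [sq_nonneg Z]
  have hZq : |Z| ≤ q := by
    refine abs_le_of_sq_le_sq (?_ : Z ^ 2 ≤ q ^ 2) hq
    have := Finset.sum_nonneg (s := Finset.univ) (f := fun i => X i ^ 2) fun i _ => sq_nonneg _
    linarith
  have hprod : ∀ {u v : ℝ}, |u| ≤ q → |v| ≤ θ * q → |u * v| ≤ θ * q ^ 2 := fun {u v} hu hv => by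
    rw [abs_mul]
    calc |u| * |v| ≤ q * (θ * q) := mul_le_mul hu hv (abs_nonneg _) hq
      _ = θ * q ^ 2 := by ring
  have hsum : ∑ i, 2 * X i * ((if i = i₀ then b * Z else 0) - a i * X i + e i)
      = 2 * b * X i₀ * Z - 2 * ∑ i, a i * X i ^ 2 + 2 * ∑ i, X i * e i := by
    have : ∀ i, 2 * X i * ((if i = i₀ then b * Z else 0) - a i * X i + e i)
        = (if i = i₀ then 2 * b * X i * Z else 0) - 2 * (a i * X i ^ 2) + 2 * (X i * e i) := by
      intro i; split_ifs <;> ring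
    simp_rw [this]
    rw [Finset.sum_add_distrib, Finset.sum_sub_distrib, ← Finset.mul_sum, ← Finset.mul_sum]
    simp
  have hXe : ∑ i, X i * e i ≤ n * (θ * q ^ 2) := by
    calc ∑ i, X i * e i ≤ ∑ _i : Fin n, θ * q ^ 2 :=
          Finset.sum_le_sum fun i _ => (le_abs_self _).trans (hprod (hXq i) (he i))
      _ = _ := by simp
  have hμX : μ * ∑ i, X i ^ 2 ≤ ∑ i, a i * X i ^ 2 := by
    rw [Finset.mul_sum]
    exact Finset.sum_le_sum fun i _ => mul_le_mul_of_nonneg_right (hμa i) (sq_nonneg _)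
  have haX : a i₀ * X i₀ ^ 2 ≤ ∑ i, a i * X i ^ 2 :=
    Finset.single_le_sum (f := fun i => a i * X i ^ 2)
      (fun i _ => mul_nonneg (hapos i).le (sq_nonneg _)) (Finset.mem_univ i₀)
  have hcross : 2 * (a i₀ * X i₀ * Z) ≤ a i₀ ^ 2 / b * X i₀ ^ 2 + b * Z ^ 2 := by
    have h : 0 ≤ (a i₀ * X i₀ - b * Z) ^ 2 / b := by positivity
    have : (a i₀ * X i₀ - b * Z) ^ 2 / b
        = a i₀ ^ 2 / b * X i₀ ^ 2 + b * Z ^ 2 - 2 * (a i₀ * X i₀ * Z) := by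
      field_simp
      ring
    linarith
  have hγcross := mul_le_mul_of_nonneg_left hcross hγ.le
  have hγX := mul_le_mul_of_nonneg_right hγa (sq_nonneg (X i₀))
  have hμZ := mul_le_mul_of_nonneg_right hμb (sq_nonneg Z)
  have h1 := mul_le_mul_of_nonneg_left ((le_abs_self _).trans (hprod hZq he₀)) hb.le
  have h2 := mul_le_mul_of_nonneg_left ((neg_le_abs _).trans (hprod hZq (he i₀))) hγ.le
  have h3 := mul_le_mul_of_nonneg_left ((neg_le_abs _).trans (hprod (hXq i₀) he₀)) hγ.le
  have h4 := mul_le_mul_of_nonneg_right hθ (sq_nonneg q)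
  have h5 : μ * q ^ 2 = μ * ∑ i, X i ^ 2 + μ * Z ^ 2 := by rw [hqQ]; ring
  rw [hsum]
  linarith

lemma isLittleO_mul_of_tendsto_zero {E : Type*} [NormedAddCommGroup E] {u v : E → ℝ}
    (hu : u =O[𝓝 0] (id : E → E)) (hv : Tendsto v (𝓝 0) (𝓝 0)) :
    (fun p => u p * v p) =o[𝓝 0] (id : E → E) := by
  have := hu.norm_right.mul_isLittleO ((isLittleO_one_iff ℝ).2 hv)
  simp only [mul_one] at this
  exact this.of_norm_right

lemma isBigO_fst_apply {n : ℕ} (i : Fin n) :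
    (fun p : (Fin n → ℝ) × ℝ => p.1 i) =O[𝓝 0] (id : (Fin n → ℝ) × ℝ → _) :=
  IsBigO.of_bound 1 (Eventually.of_forall fun p => by
    simpa using (norm_le_pi_norm p.1 i).trans (norm_fst_le p))

lemma isBigO_snd {n : ℕ} :
    (fun p : (Fin n → ℝ) × ℝ => p.2) =O[𝓝 0] (id : (Fin n → ℝ) × ℝ → _) :=
  IsBigO.of_bound 1 (Eventually.of_forall fun p => by simpa using norm_snd_le p)

lemma isLittleO_compensation {n m : ℕ} (hm : m ≠ 0) (i : Fin n) (κ χ : ℝ) :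
    (fun p : (Fin n → ℝ) × ℝ => κ * (p.1 i * p.2 + (-p.2) ^ (m + 1) * χ))
      =o[𝓝 0] (id : (Fin n → ℝ) × ℝ → _) := by
  have h1 : Tendsto (fun p : (Fin n → ℝ) × ℝ => p.2) (𝓝 0) (𝓝 0) :=
    (continuous_snd.tendsto' _ _ rfl)
  have h2 : Tendsto (fun p : (Fin n → ℝ) × ℝ => -((-p.2) ^ m * χ)) (𝓝 0) (𝓝 0) :=
    Continuous.tendsto' (by fun_prop) _ _ (by simp [hm])
  refine IsLittleO.const_mul_left ?_ κ
  refine ((isLittleO_mul_of_tendsto_zero (isBigO_fst_apply i) h1).add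
    (isLittleO_mul_of_tendsto_zero isBigO_snd h2)).congr_left fun p => ?_
  ring

lemma isLittleO_fast_remainder {n k : ℕ} (hk : 2 ≤ k) (i₀ : Fin n) (hi₀ : (i₀ : ℕ) = 0) :
    (fun p : (Fin n → ℝ) × ℝ => p.2 ^ k + ∑ i, p.1 i * p.2 ^ (i : ℕ) - p.1 i₀)
      =o[𝓝 0] (id : (Fin n → ℝ) × ℝ → _) := by
  have h1 : Tendsto (fun p : (Fin n → ℝ) × ℝ => p.2 ^ (k - 1)) (𝓝 0) (𝓝 0) :=
    Continuous.tendsto' (by fun_prop) _ _ (by simp; omega)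
  have h2 : ∀ i : Fin n, Tendsto (fun p : (Fin n → ℝ) × ℝ =>
      p.2 ^ (i : ℕ) - if i = i₀ then 1 else 0) (𝓝 0) (𝓝 0) := fun i => by
    refine Continuous.tendsto' (by fun_prop) _ _ ?_
    split_ifs with h
    · simp [h, hi₀]
    · have : (i : ℕ) ≠ 0 := fun h0 => h (Fin.ext (h0.trans hi₀.symm))
      simp [this]
  have h3 := IsLittleO.fun_sum (s := Finset.univ) fun i _ =>
    isLittleO_mul_of_tendsto_zero (isBigO_fst_apply i) (h2 i)
  refine ((isLittleO_mul_of_tendsto_zero isBigO_snd h1).add h3).congr_left fun p => ?_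
  have : p.2 * p.2 ^ (k - 1) = p.2 ^ k := mul_pow_sub_one (by omega) _
  simp [mul_sub, Finset.sum_sub_distrib, this]
  ring

/-- The closed-loop slow–fast vector field with `ε = r ^ (2 k - 1)`. -/
noncomputable def closedLoopField {n : ℕ} (k : ℕ) (i₀ : Fin n) (f : (Fin n → ℝ) × ℝ → Fin n → ℝ)
    (a : Fin n → ℝ) (b : ℝ) (K χ : Fin n → ℝ) (r : ℝ) (p : (Fin n → ℝ) × ℝ) :
    (Fin n → ℝ) × ℝ :=
  (fun i => f p i - f (0, 0) i + (if i = i₀ then b * r⁻¹ * p.2 else 0) - a i * (r ^ k)⁻¹ * p.1 i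
      + K i * (p.1 i * p.2 + (-p.2) ^ (k - (i : ℕ) + 1) * χ i),
    -(p.2 ^ k + ∑ i, p.1 i * p.2 ^ (i : ℕ)) / r ^ (2 * k - 1))

/-- The squared Euclidean norm of the rescaled state `(x / s, z)`. -/
noncomputable def scaledNormSq {n : ℕ} (s : ℝ) (p : (Fin n → ℝ) × ℝ) : ℝ := ∑ i, (p.1 i / s) ^ 2 + p.2 ^ 2

/-- The Lyapunov function in the rescaled state `(x / s, z)`. -/
noncomputable def lyapunov {n : ℕ} (i₀ : Fin n) (b γ s : ℝ) (p : (Fin n → ℝ) × ℝ) : ℝ :=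
  ∑ i, (p.1 i / s) ^ 2 + b * p.2 ^ 2 - 2 * γ * (p.1 i₀ / s * p.2)

/-- The derivative of `lyapunov` at `p` in the direction `w`. -/
noncomputable def lyapunovDeriv {n : ℕ} (i₀ : Fin n) (b γ s : ℝ) (p w : (Fin n → ℝ) × ℝ) : ℝ :=
  ∑ i, 2 * (p.1 i / s) * (w.1 i / s) + 2 * b * p.2 * w.2
    - 2 * γ * (w.1 i₀ / s * p.2 + p.1 i₀ / s * w.2)

lemma hasDerivAt_lyapunov {n : ℕ} (i₀ : Fin n) (b γ s : ℝ) (y : ℝ → (Fin n → ℝ) × ℝ)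
    (w : (Fin n → ℝ) × ℝ) (t : ℝ) (hy : HasDerivAt y w t) :
    HasDerivAt (fun t => lyapunov i₀ b γ s (y t)) (lyapunovDeriv i₀ b γ s (y t) w) t := by
  have h1 : ∀ i, HasDerivAt (fun t => (y t).1 i / s) (w.1 i / s) t := fun i =>
    (hasDerivAt_pi.1 hy.fst i).div_const s
  have h2 : HasDerivAt (fun t => (y t).2) w.2 t := hy.snd
  have h3 := HasDerivAt.fun_sum (u := Finset.univ) fun i _ => (h1 i).fun_pow 2
  refine ((h3.add ((h2.fun_pow 2).const_mul b)).sub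
    (((h1 i₀).mul h2).const_mul (2 * γ))).congr_deriv ?_
  simp only [lyapunovDeriv]
  norm_num
  ring

lemma scaledNormSq_nonneg {n : ℕ} (s : ℝ) (p : (Fin n → ℝ) × ℝ) : 0 ≤ scaledNormSq s p :=
  add_nonneg (Finset.sum_nonneg fun _ _ => sq_nonneg _) (sq_nonneg _)

lemma norm_le_sqrt_scaledNormSq {n : ℕ} {s : ℝ} (hs : 0 < s) (hs1 : s ≤ 1)
    (p : (Fin n → ℝ) × ℝ) : ‖p‖ ≤ √(scaledNormSq s p) := by
  refine max_le ((pi_norm_le_iff_of_nonneg (Real.sqrt_nonneg _)).2 fun i => ?_) ?_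
  · refine Real.abs_le_sqrt ?_
    have h1 : p.1 i ^ 2 ≤ (p.1 i / s) ^ 2 := by
      rw [div_pow, le_div_iff₀ (by positivity)]
      exact mul_le_of_le_one_right (sq_nonneg _) (pow_le_one₀ hs.le hs1)
    have h2 := Finset.single_le_sum (f := fun i => (p.1 i / s) ^ 2) (fun i _ => sq_nonneg _)
      (Finset.mem_univ i)
    have := sq_nonneg p.2
    simp only [scaledNormSq]
    linarith
  · refine Real.abs_le_sqrt ?_
    simp only [scaledNormSq]
    linarith [Finset.sum_nonneg (s := Finset.univ) (f := fun i => (p.1 i / s) ^ 2)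
      fun i _ => sq_nonneg _]

lemma lyapunov_bounds {n : ℕ} (i₀ : Fin n) {b γ : ℝ} (s : ℝ) (hb : 0 < b) (hγ : 0 < γ)
    (hγb : γ ^ 2 ≤ b / 4) (p : (Fin n → ℝ) × ℝ) :
    min (1 / 2) (b / 2) * scaledNormSq s p ≤ lyapunov i₀ b γ s p ∧
      lyapunov i₀ b γ s p ≤ (1 + b + γ) * scaledNormSq s p := by
  have h0 := Finset.single_le_sum (f := fun i => (p.1 i / s) ^ 2) (fun i _ => sq_nonneg _)
    (Finset.mem_univ i₀)
  simp only [lyapunov, scaledNormSq]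
  set S := ∑ i, (p.1 i / s) ^ 2
  set X := p.1 i₀ / s
  have hS : 0 ≤ S := (sq_nonneg X).trans h0
  have hZ := sq_nonneg p.2
  constructor
  · have h1 := mul_le_mul_of_nonneg_right (min_le_left (1 / 2) (b / 2)) hS
    have h2 := mul_le_mul_of_nonneg_right (min_le_right (1 / 2) (b / 2)) hZ
    have h3 := mul_le_mul_of_nonneg_right hγb hZ
    nlinarith [sq_nonneg (X - 2 * γ * p.2)]
  · have h1 := mul_nonneg hγ.le (sq_nonneg (X + p.2))
    have h2 := mul_le_mul_of_nonneg_left h0 hγ.le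
    have h3 := mul_nonneg hb.le hS
    nlinarith

lemma lyapunovDeriv_closedLoopField {n k : ℕ} (hk : 1 ≤ k) (i₀ : Fin n)
    (f : (Fin n → ℝ) × ℝ → Fin n → ℝ) (a : Fin n → ℝ) (b γ : ℝ) (K χ : Fin n → ℝ) {r : ℝ}
    (hr : 0 < r) (p : (Fin n → ℝ) × ℝ) :
    let s := r ^ (k - 1)
    let X := fun i => p.1 i / s
    let e := fun i => r * (f p i - f (0, 0) i
      + K i * (p.1 i * p.2 + (-p.2) ^ (k - (i : ℕ) + 1) * χ i))
    let e₀ := -((p.2 ^ k + ∑ i, p.1 i * p.2 ^ (i : ℕ) - p.1 i₀) / s)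
    lyapunovDeriv i₀ b γ s p (closedLoopField k i₀ f a b K χ r p) = (r ^ k)⁻¹ *
      (∑ i, 2 * X i * ((if i = i₀ then b * p.2 else 0) - a i * X i + e i)
        + 2 * b * p.2 * (-X i₀ + e₀)
        - 2 * γ * ((b * p.2 - a i₀ * X i₀ + e i₀) * p.2 + X i₀ * (-X i₀ + e₀))) := by
  intro s X e e₀
  have hs : 0 < s := by positivity
  have hrk : r ^ k = r * s := (mul_pow_sub_one (by omega) r).symm
  have hr2k : r ^ (2 * k - 1) = r * s ^ 2 := by
    rw [← pow_mul, ← pow_succ']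
    congr 1
    omega
  set w := closedLoopField k i₀ f a b K χ r p with hw
  have h1 : ∀ i, w.1 i / s
      = (r ^ k)⁻¹ * ((if i = i₀ then b * p.2 else 0) - a i * X i + e i) := by
    intro i
    simp only [hw, closedLoopField, X, e, hrk]
    split_ifs <;> field_simp <;> ring
  have h2 : w.2 = (r ^ k)⁻¹ * (-X i₀ + e₀) := by
    simp only [hw, closedLoopField, X, e₀, hrk, hr2k]
    field_simp
    ring
  have h3 : ∑ i, 2 * (p.1 i / s) * (w.1 i / s) = (r ^ k)⁻¹ *
      ∑ i, 2 * X i * ((if i = i₀ then b * p.2 else 0) - a i * X i + e i) := by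
    rw [Finset.mul_sum]
    exact Finset.sum_congr rfl fun i _ => by rw [h1]; ring
  rw [lyapunovDeriv, h3, h1, h2, if_pos rfl]
  ring

lemma closedLoopField_stable_and_attractive {n k : ℕ} (hk : 2 ≤ k) (hn : n < k) (i₀ : Fin n)
    (hi₀ : (i₀ : ℕ) = 0) (f : (Fin n → ℝ) × ℝ → Fin n → ℝ) (hf : ContDiff ℝ 1 f)
    (a : Fin n → ℝ) (ha : ∀ i, 0 < a i) (b : ℝ) (hb : 0 < b) (K χ : Fin n → ℝ) :
    ∃ r₀ > (0 : ℝ), ∀ r : ℝ, 0 < r → r < r₀ →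
      (∀ η > (0 : ℝ), ∃ δ > (0 : ℝ), ∀ y : ℝ → (Fin n → ℝ) × ℝ,
        (∀ t : ℝ, 0 ≤ t → HasDerivAt y (closedLoopField k i₀ f a b K χ r (y t)) t) →
        ‖y 0‖ < δ → ∀ t : ℝ, 0 ≤ t → ‖y t‖ < η) ∧
      (∃ δ₀ > (0 : ℝ), ∀ y : ℝ → (Fin n → ℝ) × ℝ,
        (∀ t : ℝ, 0 ≤ t → HasDerivAt y (closedLoopField k i₀ f a b K χ r (y t)) t) →
        ‖y 0‖ < δ₀ → Tendsto y atTop (𝓝 0)) := by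
  obtain ⟨α, hα, hαa⟩ : ∃ α > 0, ∀ i, α ≤ a i := by
    obtain ⟨j, -, hj⟩ := Finset.exists_min_image Finset.univ a ⟨i₀, Finset.mem_univ _⟩
    exact ⟨a j, ha j, fun i => hj i (Finset.mem_univ i)⟩
  have hden : 0 < 2 + a i₀ ^ 2 / b := by positivity
  obtain ⟨γ, hγ, hγb, hγa⟩ : ∃ γ > 0, γ ^ 2 ≤ b / 4 ∧ γ * (2 + a i₀ ^ 2 / b) ≤ a i₀ := by
    have hpos : 0 < min (√(b / 4)) (a i₀ / (2 + a i₀ ^ 2 / b)) :=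
      lt_min (by positivity) (div_pos (ha i₀) hden)
    exact ⟨_, hpos, (Real.le_sqrt' hpos).1 (min_le_left _ _),
      (le_div_iff₀ hden).1 (min_le_right _ _)⟩
  set μ := min α (γ * b)
  have hμ : 0 < μ := lt_min hα (by positivity)
  have hC : 0 < 2 * (n : ℝ) + 2 * b + 4 * γ := by positivity
  set θ := μ / 2 / (2 * n + 2 * b + 4 * γ)
  have hθ : 0 < θ := by positivity
  obtain ⟨L, hL, hfL⟩ : ∃ L > 0, ∀ᶠ p in 𝓝 (0 : (Fin n → ℝ) × ℝ), ‖f p - f 0‖ ≤ L * ‖p‖ := by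
    have := (hf.differentiable one_ne_zero 0).isBigO_sub
    exact this.exists_pos.imp fun L hL => ⟨hL.1, by simpa using hL.2.bound⟩
  refine ⟨min 1 (θ / (2 * L)), by positivity, fun r hr hr₀ => ?_⟩
  have hr1 : r ≤ 1 := hr₀.le.trans (min_le_left _ _)
  have hrL : r * (2 * L) ≤ θ := (le_div_iff₀ (by positivity)).1 (hr₀.le.trans (min_le_right _ _))
  have hs : 0 < r ^ (k - 1) := by positivity
  have hs1 : r ^ (k - 1) ≤ 1 := pow_le_one₀ hr.le hr1
  have hw : ∀ᶠ p in 𝓝 (0 : (Fin n → ℝ) × ℝ), ∀ i,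
      |K i * (p.1 i * p.2 + (-p.2) ^ (k - (i : ℕ) + 1) * χ i)| ≤ θ / 2 * ‖p‖ :=
    eventually_all.2 fun i =>
      (isLittleO_compensation (by omega) i (K i) (χ i)).def (half_pos hθ)
  have hz := (isLittleO_fast_remainder hk i₀ hi₀).def (mul_pos hθ hs)
  obtain ⟨ρ, hρ, hball⟩ := Metric.eventually_nhds_iff.1 (hfL.and (hw.and hz))
  have hm : 0 < min (1 / 2) (b / 2) := lt_min (by norm_num) (by positivity)
  refine stable_and_attractive_of_lyapunov _ (lyapunov i₀ b γ (r ^ (k - 1)))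
    (lyapunovDeriv i₀ b γ (r ^ (k - 1))) (c := (r ^ k)⁻¹ * (μ / 2) / (1 + b + γ)) hm
    (by positivity) hρ (hasDerivAt_lyapunov i₀ b γ _) (fun p => ?_) ?_ (fun p hp => ?_)
  · refine le_trans (mul_le_mul_of_nonneg_left ?_ hm.le) (lyapunov_bounds i₀ _ hb hγ hγb p).1
    rw [← Real.sq_sqrt (scaledNormSq_nonneg (r ^ (k - 1)) p)]
    exact pow_le_pow_left₀ (norm_nonneg p) (norm_le_sqrt_scaledNormSq hs hs1 p) 2
  · refine Continuous.tendsto' ?_ _ _ (by simp [lyapunov])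
    unfold lyapunov
    fun_prop
  · obtain ⟨hfp, hwp, hzp⟩ := hball (y := p) (by simpa using hp)
    have hpq := norm_le_sqrt_scaledNormSq hs hs1 p
    have hθpq := mul_le_mul_of_nonneg_left hpq hθ.le
    rw [lyapunovDeriv_closedLoopField (by omega) i₀ f a b γ K χ hr p]
    have hdiss := lyapunov_dissipation i₀ a (fun i => p.1 i / r ^ (k - 1))
      (fun i => r * (f p i - f (0, 0) i
        + K i * (p.1 i * p.2 + (-p.2) ^ (k - (i : ℕ) + 1) * χ i)))
      (e₀ := -((p.2 ^ k + ∑ i, p.1 i * p.2 ^ (i : ℕ) - p.1 i₀) / r ^ (k - 1)))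
      (Z := p.2) (μ := μ) (θ := θ) (q := √(scaledNormSq (r ^ (k - 1)) p)) hb hγ hγa (fun i => (min_le_left _ _).trans (hαa i)) ha
      (min_le_right _ _) (Real.sqrt_nonneg _) (Real.sq_sqrt (scaledNormSq_nonneg _ p))
      (div_mul_cancel₀ _ hC.ne').le (fun i => ?_) ?_
    · refine (mul_le_mul_of_nonneg_left hdiss (by positivity)).trans ?_
      rw [Real.sq_sqrt (scaledNormSq_nonneg _ p)]
      have h := (div_le_iff₀' (by positivity)).2 (lyapunov_bounds i₀ (r ^ (k - 1)) hb hγ hγb p).2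
      have hc : 0 ≤ (r ^ k)⁻¹ * (μ / 2) := by positivity
      have := mul_le_mul_of_nonneg_left h hc
      calc _ = -((r ^ k)⁻¹ * (μ / 2) * scaledNormSq (r ^ (k - 1)) p) := by ring
        _ ≤ -((r ^ k)⁻¹ * (μ / 2)
            * (lyapunov i₀ b γ (r ^ (k - 1)) p / (1 + b + γ))) := neg_le_neg this
        _ = _ := by ring
    · refine le_trans ?_ hθpq
      have hfi : |f p i - f (0, 0) i| ≤ L * ‖p‖ := (norm_le_pi_norm (f p - f 0) i).trans hfp
      have h1 := (abs_add_le _ _).trans (add_le_add hfi (hwp i))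
      rw [abs_mul, abs_of_pos hr]
      have h2 := mul_le_mul_of_nonneg_left h1 hr.le
      have h3 := mul_le_mul_of_nonneg_right hrL (norm_nonneg p)
      have h4 := mul_le_mul_of_nonneg_right hr1 (mul_nonneg hθ.le (norm_nonneg p))
      linarith
    · refine le_trans ?_ hθpq
      rw [abs_neg, abs_div, abs_of_pos hs, div_le_iff₀ hs]
      refine hzp.trans_eq ?_
      simp only [id]
      ring

/-- local asymptotic stability part of Theorem 3 of the paper.
Adding the compensation `wᵢ = Kᵢ (xᵢ z + (−z)^{k−i+2} χᵢ*)` (with `Kᵢ ≥ 0`) to the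
controller of Theorem 2 preserves local asymptotic stability of the origin of the
closed-loop slow–fast system, for all `ε > 0` sufficiently small.
Here `x : Fin (k-1) → ℝ` is 0-indexed, so the paper's `xᵢ` is `x ⟨i-1,_⟩`,
the exponent `k−i+2` is `k - (i : ℕ) + 1`, and `z^{i-1}` is `z ^ (i : ℕ)`. -/
theorem slow_fast_compensated_controller_local_asymptotic_stability
    (k : ℕ) (hk : 2 ≤ k)
    (f : (Fin (k - 1) → ℝ) × ℝ → Fin (k - 1) → ℝ)
    (hf : ContDiff ℝ 1 f)
    (a : Fin (k - 1) → ℝ) (ha : ∀ i, 0 < a i)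
    (b : ℝ) (hb : 0 < b)
    (K : Fin (k - 1) → ℝ) (hK : ∀ i, 0 ≤ K i)
    (χs : Fin (k - 1) → ℝ) :
    ∃ ε₀ > (0 : ℝ), ∀ ε : ℝ, 0 < ε → ε < ε₀ →
      -- (i) Lyapunov stability of the origin
      ((∀ η > (0 : ℝ), ∃ δ > (0 : ℝ),
        ∀ sol : ℝ → (Fin (k - 1) → ℝ) × ℝ,
          (∀ t : ℝ, 0 ≤ t → HasDerivAt sol
            ((fun i => f (sol t) i - f (0, 0) i
                + (if i = (⟨0, by omega⟩ : Fin (k - 1)) then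
                    b * ε ^ (-(1 : ℝ) / (2 * (k : ℝ) - 1)) * (sol t).2 else 0)
                - a i * ε ^ (-(k : ℝ) / (2 * (k : ℝ) - 1)) * (sol t).1 i
                + K i * ((sol t).1 i * (sol t).2
                    + (-(sol t).2) ^ (k - (i : ℕ) + 1) * χs i),
              -(((sol t).2) ^ k
                  + ∑ i : Fin (k - 1), (sol t).1 i * ((sol t).2) ^ (i : ℕ)) / ε)) t) →
          ‖sol 0‖ < δ → ∀ t : ℝ, 0 ≤ t → ‖sol t‖ < η) ∧
      -- (ii) local attractivity of the origin
      (∃ δ₀ > (0 : ℝ),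
        ∀ sol : ℝ → (Fin (k - 1) → ℝ) × ℝ,
          (∀ t : ℝ, 0 ≤ t → HasDerivAt sol
            ((fun i => f (sol t) i - f (0, 0) i
                + (if i = (⟨0, by omega⟩ : Fin (k - 1)) then
                    b * ε ^ (-(1 : ℝ) / (2 * (k : ℝ) - 1)) * (sol t).2 else 0)
                - a i * ε ^ (-(k : ℝ) / (2 * (k : ℝ) - 1)) * (sol t).1 i
                + K i * ((sol t).1 i * (sol t).2
                    + (-(sol t).2) ^ (k - (i : ℕ) + 1) * χs i),
              -(((sol t).2) ^ k
                  + ∑ i : Fin (k - 1), (sol t).1 i * ((sol t).2) ^ (i : ℕ)) / ε)) t) →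
          ‖sol 0‖ < δ₀ → Tendsto sol atTop (nhds 0))) := by
  obtain ⟨r₀, hr₀, h⟩ := closedLoopField_stable_and_attractive hk (by omega)
    (⟨0, by omega⟩ : Fin (k - 1)) rfl f hf a ha b hb K χs
  have hcast : ((2 * k - 1 : ℕ) : ℝ) = 2 * (k : ℝ) - 1 := by
    rw [Nat.cast_sub (by omega)]
    push_cast
    ring
  have hodd : 2 * k - 1 ≠ 0 := by omega
  have hne : (2 * (k : ℝ) - 1) ≠ 0 := hcast ▸ Nat.cast_ne_zero.2 hodd
  refine ⟨r₀ ^ (2 * k - 1), by positivity, fun ε hε hε₀ => ?_⟩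
  obtain ⟨r, hr, rfl⟩ : ∃ r > 0, r ^ (2 * k - 1) = ε :=
    ⟨ε ^ ((2 * k - 1 : ℕ) : ℝ)⁻¹, by positivity, Real.rpow_inv_natCast_pow hε.le hodd⟩
  have hb' : (r ^ (2 * k - 1)) ^ (-(1 : ℝ) / (2 * (k : ℝ) - 1)) = r⁻¹ := by
    rw [← Real.rpow_natCast, ← Real.rpow_mul hr.le, hcast, mul_div_cancel₀ _ hne,
      Real.rpow_neg_one]
  have ha' : (r ^ (2 * k - 1)) ^ (-(k : ℝ) / (2 * (k : ℝ) - 1)) = (r ^ k)⁻¹ := by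
    rw [← Real.rpow_natCast, ← Real.rpow_mul hr.le, hcast, mul_div_cancel₀ _ hne,
      Real.rpow_neg hr.le, Real.rpow_natCast]
  simp only [hb', ha']
  exact h r hr (lt_of_pow_lt_pow_left₀ _ hr₀.le hε₀)
end
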